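/- (Explicit description of the norm quotient, from the proof of Lemma 4.3(2).) For all sufficiently large r (depending only on E/F and θ) the following holds. Let a ∈ F^× with v(a) = s ≥ r. Then the map x ↦ 1 − a(1 + ϖ^r x) induces a bijection from the quotient group O_F/Tr_{E/F}(O_E) onto the quotient of the set 1 − a(1 + ϖ^rO_F) by the equivalence relation y ∼ y' if and only if y/y' ∈ q(1 + ϖ^{r+s}O_E). -/

import Mathlib

/-- The ring of integers of a `p`-adic field: the integral closure of `ℤ_[p]`. -/
noncomputable def ringOfIntegers (p : ℕ) [Fact p.Prime] (K : Type*) [Field K]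
    [Algebra ℚ_[p] K] : Subring K :=
  letI : Algebra ℤ_[p] K :=
    ((algebraMap ℚ_[p] K).comp (PadicInt.Coe.ringHom)).toAlgebra
  (integralClosure ℤ_[p] K).toSubring

/-- The subset `1 + ϖ^n O_E` of `E`. -/
def onePlusSet (p : ℕ) [Fact p.Prime] (F E : Type*) [Field F] [Field E]
    [Algebra ℚ_[p] F] [Algebra ℚ_[p] E] [Algebra F E]
    (ϖ : ringOfIntegers p F) (n : ℕ) : Set E :=
  {t | ∃ y ∈ ringOfIntegers p E, t = 1 + algebraMap F E ((ϖ : F) ^ n) * y}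

open Polynomial in
/-- An element of a `p`-adic field is an integer iff its spectral norm is at most one. -/
theorem mem_ringOfIntegers_iff_spectralNorm_le_one (p : ℕ) [Fact p.Prime] {K : Type*} [Field K]
    [Algebra ℚ_[p] K] [FiniteDimensional ℚ_[p] K] (x : K) :
    x ∈ ringOfIntegers p K ↔ spectralNorm ℚ_[p] K x ≤ 1 := by
  let _ : Algebra ℤ_[p] K :=
    ((algebraMap ℚ_[p] K).comp (PadicInt.Coe.ringHom)).toAlgebra
  have : IsScalarTower ℤ_[p] ℚ_[p] K := IsScalarTower.of_algebraMap_eq fun _ => rfl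
  have hint : IsIntegral ℚ_[p] x := Algebra.IsIntegral.isIntegral x
  have hmem : x ∈ ringOfIntegers p K ↔ IsIntegral ℤ_[p] x := Iff.rfl
  rw [hmem, spectralNorm, spectralValue_le_one_iff (minpoly.monic hint)]
  constructor
  · intro hx n
    rw [minpoly.isIntegrallyClosed_eq_field_fractions' ℚ_[p] hx, coeff_map]
    exact PadicInt.norm_le_one _
  · intro h
    have hl : minpoly ℚ_[p] x ∈ lifts (algebraMap ℤ_[p] ℚ_[p]) := by
      rw [lifts_iff_coeff_lifts]
      exact fun n => ⟨⟨_, h n⟩, rfl⟩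
    obtain ⟨P, hP, -, hmonic⟩ := lifts_and_natDegree_eq_and_monic hl (minpoly.monic hint)
    refine ⟨P, hmonic, ?_⟩
    rw [← aeval_def, ← aeval_map_algebraMap ℚ_[p], hP, minpoly.aeval]

/-- A quadratic equation that is a small perturbation of `z = 0` has an integral solution. -/
theorem exists_norm_le_one_add_mul_eq_zero {K : Type*} [NormedField K] [IsUltrametricDist K]
    [CompleteSpace K] {m N T : K} (hm : ‖m‖ < 1) (hN : ‖N‖ ≤ 1) (hT : ‖T‖ ≤ 1) :
    ∃ z : K, ‖z‖ ≤ 1 ∧ z + m * (N + z * T + z ^ 2) = 0 := by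
  have hadd : ∀ {x y : K}, ‖x‖ ≤ 1 → ‖y‖ ≤ 1 → ‖x + y‖ ≤ 1 := fun hx hy =>
    (IsUltrametricDist.norm_add_le_max _ _).trans (max_le hx hy)
  have hmul : ∀ {x y : K}, ‖x‖ ≤ 1 → ‖y‖ ≤ 1 → ‖x * y‖ ≤ 1 := fun hx hy => by
    rw [norm_mul]; exact mul_le_one₀ hx (norm_nonneg _) hy
  let f : K → K := fun z => -(m * (N + z * T + z ^ 2))
  have hmaps : Set.MapsTo f (Metric.closedBall 0 1) (Metric.closedBall 0 1) := by
    intro z hz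
    rw [mem_closedBall_zero_iff] at hz ⊢
    simp only [f, norm_neg, sq]
    exact hmul hm.le (hadd (hadd hN (hmul hz hT)) (hmul hz hz))
  have hcontr : ContractingWith ‖m‖₊ (hmaps.restrict f _ _) := by
    refine ⟨hm, LipschitzWith.of_dist_le_mul ?_⟩
    rintro ⟨z, hz⟩ ⟨z', hz'⟩
    rw [mem_closedBall_zero_iff] at hz hz'
    change dist (f z) (f z') ≤ ‖m‖ * dist z z'
    have he : f z - f z' = m * ((z' - z) * (T + z + z')) := by simp only [f]; ring
    rw [dist_eq_norm, dist_eq_norm, he, norm_mul, norm_mul, norm_sub_rev z' z]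
    exact mul_le_mul_of_nonneg_left
      (mul_le_of_le_one_right (norm_nonneg _) (hadd (hadd hT hz) hz')) (norm_nonneg _)
  obtain ⟨z, hz, hfix, -⟩ := hcontr.exists_fixedPoint' Metric.isClosed_closedBall.isComplete hmaps
    (Metric.mem_closedBall_self zero_le_one) (edist_ne_top _ _)
  refine ⟨z, mem_closedBall_zero_iff.1 hz, ?_⟩
  have hz' : -(m * (N + z * T + z ^ 2)) = z := hfix
  linear_combination -hz'

/-- Large powers of a uniformizer `ϖ` are divisible by `2`, with quotient so small that the
associated quadratic equations are solvable in the ring of integers. -/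
theorem exists_forall_uniformizer_pow (p : ℕ) [Fact p.Prime] {F : Type*} [Field F]
    [Algebra ℚ_[p] F] [FiniteDimensional ℚ_[p] F] (ϖ : ringOfIntegers p F)
    (hϖ : ¬ IsUnit ϖ) :
    ∃ r₀ : ℕ, 1 ≤ r₀ ∧ ∀ n : ℕ, r₀ ≤ n →
      (∀ x ∈ ringOfIntegers p F, 1 - (ϖ : F) ^ n * x ≠ 0 ∧
        (1 - (ϖ : F) ^ n * x)⁻¹ ∈ ringOfIntegers p F) ∧
      ∃ m ∈ ringOfIntegers p F, (ϖ : F) ^ n = 2 * m ∧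
        ∀ N ∈ ringOfIntegers p F, ∀ T ∈ ringOfIntegers p F,
          ∃ z ∈ ringOfIntegers p F, z + m * (N + z * T + z ^ 2) = 0 := by
  let _ : NormedField F := spectralNorm.normedField ℚ_[p] F
  have : CompleteSpace F := spectralNorm.completeSpace ℚ_[p] F
  have : IsUltrametricDist F :=
    IsUltrametricDist.isUltrametricDist_of_isNonarchimedean_norm
      (isNonarchimedean_spectralNorm (K := ℚ_[p]) (L := F))
  have : CharZero F := charZero_of_injective_algebraMap (algebraMap ℚ_[p] F).injective
  have hO : ∀ x : F, x ∈ ringOfIntegers p F ↔ ‖x‖ ≤ 1 :=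
    mem_ringOfIntegers_iff_spectralNorm_le_one p
  have hlt : ‖(ϖ : F)‖ < 1 := by
    refine lt_of_le_of_ne ((hO _).1 ϖ.2) fun h => hϖ ?_
    have h0 : (ϖ : F) ≠ 0 := norm_ne_zero_iff.1 (by rw [h]; exact one_ne_zero)
    refine IsUnit.of_mul_eq_one ⟨(ϖ : F)⁻¹, (hO _).2 (by rw [norm_inv, h, inv_one])⟩ ?_
    exact Subtype.ext (mul_inv_cancel₀ h0)
  have h2 : (0 : ℝ) < ‖(2 : F)‖ := norm_pos_iff.2 two_ne_zero
  obtain ⟨k, hk⟩ := exists_pow_lt_of_lt_one h2 hlt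
  refine ⟨k + 1, by omega, fun n hn => ⟨fun x hx => ?_, (ϖ : F) ^ n / 2, ?_⟩⟩
  · have hx1 : ‖(ϖ : F) ^ n * x‖ < 1 := by
      rw [norm_mul, norm_pow]
      exact mul_lt_one_of_nonneg_of_lt_one_left (by positivity)
        (pow_lt_one₀ (norm_nonneg _) hlt (by omega)) ((hO _).1 hx)
    have h1 : ‖1 - (ϖ : F) ^ n * x‖ = 1 := by
      rw [sub_eq_add_neg, IsUltrametricDist.norm_add_eq_max_of_norm_ne_norm]
      · rw [norm_neg, norm_one, max_eq_left hx1.le]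
      · rw [norm_neg, norm_one]; exact hx1.ne'
    exact ⟨norm_ne_zero_iff.1 (by rw [h1]; exact one_ne_zero),
      (hO _).2 (by rw [norm_inv, h1, inv_one])⟩
  · have hm : ‖(ϖ : F) ^ n / 2‖ < 1 := by
      rw [norm_div, norm_pow, div_lt_one h2]
      exact (pow_le_pow_of_le_one (norm_nonneg _) hlt.le (by omega)).trans_lt hk
    refine ⟨(hO _).2 hm.le, by rw [mul_div_cancel₀ _ two_ne_zero], fun N hN T hT => ?_⟩
    obtain ⟨z, hz, h⟩ := exists_norm_le_one_add_mul_eq_zero hm ((hO _).1 hN) ((hO _).1 hT)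
    exact ⟨z, (hO _).2 hz, h⟩

/-- If `S = R + θ R` inside a field extension and `c` is an automorphism moving `θ`, then
`y + c y` and `y * c y` lie in `R` for all `y ∈ S`. -/
theorem add_conj_mem_and_mul_conj_mem {F E : Type*} [Field F] [Field E] [Algebra F E]
    (R : Subring F) (S : Subring E) (c : E ≃ₐ[F] E) {θ : E} (hθ : θ ∈ S)
    (hgen : ∀ x : E, x ∈ S ↔ ∃ a b : R, x = algebraMap F E (a : F) + θ * algebraMap F E (b : F))
    (hθc : c θ ≠ θ) {y : E} (hy : y ∈ S) :
    (∃ T ∈ R, y + c y = algebraMap F E T) ∧ ∃ N ∈ R, y * c y = algebraMap F E N := by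
  obtain ⟨B, A, hAB⟩ := (hgen (θ * θ)).1 (S.mul_mem hθ hθ)
  have hAB' := congrArg c hAB
  simp only [map_mul, map_add, AlgEquiv.commutes] at hAB'
  have hc : c θ = algebraMap F E (A : F) - θ := by
    refine mul_left_cancel₀ (sub_ne_zero.2 hθc) ?_
    linear_combination hAB' - hAB
  obtain ⟨α, β, rfl⟩ := (hgen y).1 hy
  refine ⟨⟨_, (α + α + A * β : R).2, ?_⟩, ⟨_, (α * α + A * α * β - B * β * β : R).2, ?_⟩⟩
  · simp only [map_mul, map_add, AlgEquiv.commutes, hc, Subring.coe_add, Subring.coe_mul]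
    ring
  · simp only [map_mul, map_add, map_sub, AlgEquiv.commutes, hc, Subring.coe_add, Subring.coe_mul,
      AddSubgroupClass.coe_sub]
    linear_combination (-algebraMap F E (β : F) ^ 2) * hAB

/-- **Explicit description of the norm quotient (from the proof of Lemma 4.3(2)).**
Let `F` be a finite extension of `ℚ_p` with ring of integers `O_F` and uniformizer `ϖ`, let
`E/F` be a quadratic extension with ring of integers `O_E = O_F + θ·O_F`, `c` the nontrivial
`F`-automorphism, `q = N_{E/F}` and `Tr = Tr_{E/F}`.  For all sufficiently large `r` the
following holds: for `a ∈ F^×` with `v(a) = s ≥ r`, the map `x ↦ 1 − a(1 + ϖ^r x)` induces a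
bijection from `O_F/Tr(O_E)` onto the quotient of `1 − a(1 + ϖ^r O_F)` by the equivalence
relation `y ∼ y' ⟺ y/y' ∈ q(1 + ϖ^{r+s}O_E)`: it is surjective onto `1 − a(1 + ϖ^r O_F)`,
and `(1 − a(1 + ϖ^r x)) ∼ (1 − a(1 + ϖ^r x'))` if and only if `x − x' ∈ Tr(O_E)`. -/
theorem norm_quotient_description
    (p : ℕ) [Fact p.Prime]
    (F : Type*) [Field F] [Algebra ℚ_[p] F] [FiniteDimensional ℚ_[p] F]
    (E : Type*) [Field E] [Algebra ℚ_[p] E] [Algebra F E] [IsScalarTower ℚ_[p] F E]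
    (hquad : Module.finrank F E = 2)
    (c : E ≃ₐ[F] E)
    (ϖ : ringOfIntegers p F) (hϖ : Irreducible ϖ)
    (θ : E) (hθmem : θ ∈ ringOfIntegers p E)
    (hgen : ∀ x : E, x ∈ ringOfIntegers p E ↔
      ∃ a b : ringOfIntegers p F, x = algebraMap F E (a : F) + θ * algebraMap F E (b : F))
    (hθc : c θ ≠ θ) :
    ∃ r₀ : ℕ, 1 ≤ r₀ ∧ ∀ r : ℕ, r₀ ≤ r → ∀ s : ℕ, r ≤ s → ∀ a : F,
      (∃ w : (ringOfIntegers p F)ˣ, a = (ϖ : F) ^ s * ((w : ringOfIntegers p F) : F)) →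
      -- the induced map is well defined and injective on the quotient `O_F/Tr(O_E)`
      ((∀ x x' : ringOfIntegers p F,
        ((∃ t ∈ onePlusSet p F E ϖ (r + s),
            algebraMap F E (1 - a * (1 + (ϖ : F) ^ r * (x : F))) =
              algebraMap F E (1 - a * (1 + (ϖ : F) ^ r * (x' : F))) * (t * c t)) ↔
          (∃ w ∈ ringOfIntegers p E,
            algebraMap F E ((x : F) - (x' : F)) = w + c w))) ∧
      -- and it is surjective onto `1 − a(1 + ϖ^r O_F)`
      (∀ y : F, (∃ u ∈ ringOfIntegers p F, y = 1 - a * (1 + (ϖ : F) ^ r * u)) →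
        ∃ x : ringOfIntegers p F, y = 1 - a * (1 + (ϖ : F) ^ r * (x : F)))) := by
  obtain ⟨r₀, hr₀, hr⟩ := exists_forall_uniformizer_pow p ϖ hϖ.not_isUnit
  refine ⟨r₀, hr₀, ?_⟩
  rintro r hr₀r s hrs a ⟨w, rfl⟩
  refine ⟨fun x x' => ?_, fun y ⟨u, hu, hy⟩ => ⟨⟨u, hu⟩, hy⟩⟩
  have hinj : Function.Injective (algebraMap F E) := (algebraMap F E).injective
  have hϖ0 : (ϖ : F) ≠ 0 := fun h => hϖ.ne_zero (Subtype.ext h)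
  have hFE : ∀ z ∈ ringOfIntegers p F, algebraMap F E z ∈ ringOfIntegers p E := fun z hz =>
    (hgen _).2 ⟨⟨z, hz⟩, 0, by simp⟩
  have htn := fun {y : E} => add_conj_mem_and_mul_conj_mem _ _ c hθmem hgen hθc (y := y)
  obtain ⟨hunit, -⟩ := hr s (hr₀r.trans hrs)
  obtain ⟨-, m, hm, hm2, hsolve⟩ := hr (r + s) (by omega)
  obtain ⟨hu0, huinv⟩ := hunit _ (w * (1 + ϖ ^ r * x') : ringOfIntegers p F).2
  have hu := (1 - ϖ ^ s * (w * (1 + ϖ ^ r * x')) : ringOfIntegers p F).2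
  have hww : ((w : ringOfIntegers p F) : F) * ((w⁻¹ : (ringOfIntegers p F)ˣ) : ringOfIntegers p F)
      = 1 := by
    exact_mod_cast congrArg Subtype.val w.mul_inv
  push_cast at hu0 huinv hu
  set W : F := ((w : ringOfIntegers p F) : F)
  set W' : F := (((w⁻¹ : (ringOfIntegers p F)ˣ) : ringOfIntegers p F) : F)
  have hWmem : W ∈ ringOfIntegers p F := (w : ringOfIntegers p F).2
  have hW'mem : W' ∈ ringOfIntegers p F := ((w⁻¹ : (ringOfIntegers p F)ˣ) : ringOfIntegers p F).2
  set u : F := 1 - (ϖ : F) ^ s * (W * (1 + (ϖ : F) ^ r * x'))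
  have key : ∀ (y : E) (T N : F), y + c y = algebraMap F E T → y * c y = algebraMap F E N →
      (algebraMap F E (1 - (ϖ : F) ^ s * W * (1 + (ϖ : F) ^ r * (x : F))) =
        algebraMap F E (1 - (ϖ : F) ^ s * W * (1 + (ϖ : F) ^ r * (x' : F))) *
          ((1 + algebraMap F E ((ϖ : F) ^ (r + s)) * y) *
            c (1 + algebraMap F E ((ϖ : F) ^ (r + s)) * y)) ↔
        W * ((x : F) - x') = -u * (T + 2 * m * N)) := by
    intro y T N hT hN
    have ht : (1 + algebraMap F E ((ϖ : F) ^ (r + s)) * y) *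
        c (1 + algebraMap F E ((ϖ : F) ^ (r + s)) * y) =
        algebraMap F E (1 + (ϖ : F) ^ (r + s) * (T + (ϖ : F) ^ (r + s) * N)) := by
      simp only [map_add, map_mul, map_one, AlgEquiv.commutes, ← hT, ← hN]
      ring
    rw [ht, ← map_mul, hinj.eq_iff, ← hm2]
    constructor <;> intro h
    · refine mul_left_cancel₀ (pow_ne_zero (r + s) hϖ0) ?_
      linear_combination -h
    · linear_combination -(ϖ : F) ^ (r + s) * h
  constructor
  · rintro ⟨_, ⟨y, hy, rfl⟩, h⟩
    obtain ⟨⟨T, -, hT⟩, N, hN, hyN⟩ := htn hy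
    rw [key y T N hT hyN] at h
    refine ⟨algebraMap F E (-(W' * u)) * (y + algebraMap F E (m * N)), ?_, ?_⟩
    · exact mul_mem (hFE _ (neg_mem (mul_mem hW'mem hu))) (add_mem hy (hFE _ (mul_mem hm hN)))
    · have h' : (x : F) - x' = -(W' * u) * (T + 2 * (m * N)) := by
        linear_combination W' * h - ((x : F) - x') * hww
      rw [h', map_mul, map_add, ← hT]
      simp only [map_mul, map_add, AlgEquiv.commutes, map_ofNat]
      ring
  · rintro ⟨y₀, hy₀, h⟩
    have hv : -(W * u⁻¹) ∈ ringOfIntegers p F := neg_mem (mul_mem hWmem huinv)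
    obtain ⟨⟨T, hT, hyT⟩, N, hN, hyN⟩ := htn (mul_mem (hFE _ hv) hy₀)
    obtain ⟨z, hz, hzeq⟩ := hsolve N hN T hT
    refine ⟨_, ⟨algebraMap F E (-(W * u⁻¹)) * y₀ + algebraMap F E z,
      add_mem (mul_mem (hFE _ hv) hy₀) (hFE _ hz), rfl⟩, ?_⟩
    rw [key _ (T + 2 * z) (N + z * T + z ^ 2)]
    · have hTv : T = -(W * u⁻¹) * ((x : F) - x') := by
        refine hinj ?_
        rw [← hyT, map_mul _ _ ((x : F) - x'), h, map_mul, AlgEquiv.commutes]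
        ring
      have huu : u * u⁻¹ = 1 := mul_inv_cancel₀ hu0
      linear_combination u * hTv - W * ((x : F) - x') * huu + 2 * u * hzeq
    · rw [map_add c, AlgEquiv.commutes, map_add (algebraMap F E), two_mul z,
        map_add (algebraMap F E), ← hyT]
      ring
    · rw [map_add c, AlgEquiv.commutes]
      simp only [map_add (algebraMap F E), map_mul (algebraMap F E) z, map_pow, ← hyT, ← hyN]
      ring
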